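/- Let (Ω, μ) be a probability measure space, let k ≥ 1, p ≥ 1, R > 0, and let r, Z_N, ψ : Ω → ℝ be measurable with 0 ≤ r ≤ R and ψ² ≤ r² − Z_N² μ-almost everywhere (in particular |Z_N| ≤ r). Let H₀ = 1 and let H₁, …, H_k : Ω → ℝ be positive μ-a.e., with H_k ∈ L^{2p}(μ) and h := ‖H_k‖_{L^{2p}(μ)}, and assume ∫ H_{j−1} dμ ≤ ∫ H_j · r dμ for every 1 ≤ j ≤ k−1, and ∫ H_{k−1} dμ ≤ ∫ H_k · Z_N dμ. If 0 < C < 1 and R^k < 1/h + C, then ∫ ψ² dμ ≤ C · ( h^{(2k−2)/k} + 2 h^{(k−2)/k} ). -/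

import Mathlib

open MeasureTheory

/-- On a probability space, the second moment is bounded by the squared `L^{2p}` norm. -/
theorem integral_sq_le_sq_of_integrable_rpow {Ω : Type*} [MeasurableSpace Ω] {μ : Measure Ω}
    [IsProbabilityMeasure μ] {f : Ω → ℝ} (hf : AEStronglyMeasurable f μ) {p : ℝ} (hp : 1 ≤ p)
    (hfp : Integrable (fun x => |f x| ^ (2 * p)) μ) :
    MemLp f 2 μ ∧
      ∫ x, f x ^ 2 ∂μ ≤ ((∫ x, |f x| ^ (2 * p) ∂μ) ^ (1 / (2 * p))) ^ 2 := by
  have hp0 : 0 ≤ 2 * p := by linarith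
  have hq0 : ENNReal.ofReal (2 * p) ≠ 0 := by
    simp only [ne_eq, ENNReal.ofReal_eq_zero, not_le]; linarith
  have hle : (2 : ENNReal) ≤ ENNReal.ofReal (2 * p) := by
    rw [← ENNReal.ofReal_ofNat 2]; exact ENNReal.ofReal_le_ofReal (by linarith)
  have hmem : MemLp f (ENNReal.ofReal (2 * p)) μ := by
    rw [← integrable_norm_rpow_iff hf hq0 ENNReal.ofReal_ne_top, ENNReal.toReal_ofReal hp0]
    simpa only [Real.norm_eq_abs] using hfp
  have hmem2 : MemLp f 2 μ := hmem.mono_exponent hle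
  refine ⟨hmem2, ?_⟩
  have key := eLpNorm_le_eLpNorm_of_exponent_le hle hf
  rw [hmem.eLpNorm_eq_integral_rpow_norm hq0 ENNReal.ofReal_ne_top,
    hmem2.eLpNorm_eq_integral_rpow_norm two_ne_zero ENNReal.ofNat_ne_top,
    ENNReal.ofReal_le_ofReal_iff (by positivity), ENNReal.toReal_ofReal hp0] at key
  simp only [ENNReal.toReal_ofNat, Real.norm_eq_abs, Real.rpow_ofNat, sq_abs] at key
  have h0 : 0 ≤ ∫ x, f x ^ 2 ∂μ := integral_nonneg fun x => sq_nonneg _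
  calc ∫ x, f x ^ 2 ∂μ = ((∫ x, f x ^ 2 ∂μ) ^ (2⁻¹ : ℝ)) ^ 2 := by
        rw [← Real.rpow_natCast, ← Real.rpow_mul h0]; norm_num
    _ ≤ _ := by
        rw [one_div]
        gcongr

/-- The Cauchy–Schwarz inequality for real square-integrable functions. -/
theorem sq_integral_mul_le {Ω : Type*} [MeasurableSpace Ω] {μ : Measure Ω} {f g : Ω → ℝ}
    (hf : MemLp f 2 μ) (hg : MemLp g 2 μ) :
    (∫ x, f x * g x ∂μ) ^ 2 ≤ (∫ x, f x ^ 2 ∂μ) * ∫ x, g x ^ 2 ∂μ := by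
  have hfg : Integrable (fun x => f x * g x) μ := hf.integrable_mul hg
  have h : ∀ t : ℝ, 0 ≤ (∫ x, g x ^ 2 ∂μ) * (t * t) + (-2 * ∫ x, f x * g x ∂μ) * t
      + ∫ x, f x ^ 2 ∂μ := fun t => by
    have hnn : 0 ≤ ∫ x, (g x ^ 2 * (t * t) + f x * g x * (-2 * t) + f x ^ 2) ∂μ :=
      integral_nonneg fun x => by
        have := sq_nonneg (f x - t * g x)
        simp only [Pi.zero_apply]
        linarith
    have hadd : Integrable (fun x => g x ^ 2 * (t * t) + f x * g x * (-2 * t)) μ :=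
      (hg.integrable_sq.mul_const _).add (hfg.mul_const _)
    rw [integral_add hadd hf.integrable_sq,
      integral_add (hg.integrable_sq.mul_const _) (hfg.mul_const _), integral_mul_const,
      integral_mul_const] at hnn
    linarith
  have := discrim_le_zero h
  rw [discrim] at this
  linarith

/-- Iterating Minkowski-type inequalities `∫ H_{j-1} ≤ ∫ H_j r` with `r ≤ R`. -/
theorem one_le_pow_mul_integral {Ω : Type*} [MeasurableSpace Ω] {μ : Measure Ω}
    [IsProbabilityMeasure μ] {R : ℝ} (hR : 0 ≤ R) {r : Ω → ℝ} (hr : ∀ᵐ x ∂μ, r x ≤ R)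
    {H : ℕ → Ω → ℝ} (hH0 : ∀ x, H 0 x = 1) {m : ℕ} (hint : ∀ j ≤ m, Integrable (H j) μ)
    (hpos : ∀ j, 1 ≤ j → j ≤ m → ∀ᵐ x ∂μ, 0 < H j x)
    (hrint : ∀ j ≤ m, Integrable (fun x => H j x * r x) μ)
    (hmink : ∀ j, 1 ≤ j → j ≤ m → ∫ x, H (j - 1) x ∂μ ≤ ∫ x, H j x * r x ∂μ) :
    ∀ j ≤ m, 1 ≤ R ^ j * ∫ x, H j x ∂μ := by
  intro j
  induction j with
  | zero => intro _; simp [hH0]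
  | succ j ih =>
    intro hj
    have hstep : ∫ x, H (j + 1) x * r x ∂μ ≤ (∫ x, H (j + 1) x ∂μ) * R := by
      rw [← integral_mul_const]
      refine integral_mono_ae (hrint _ hj) ((hint _ hj).mul_const R) ?_
      filter_upwards [hr, hpos (j + 1) (by omega) hj] with x hx hHx
      exact mul_le_mul_of_nonneg_left hx hHx.le
    have hm := hmink (j + 1) (by omega) hj
    rw [Nat.add_sub_cancel] at hm
    calc (1 : ℝ) ≤ R ^ j * ∫ x, H j x ∂μ := ih (by omega)
      _ ≤ R ^ j * ((∫ x, H (j + 1) x ∂μ) * R) := by gcongr; exact hm.trans hstep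
      _ = R ^ (j + 1) * ∫ x, H (j + 1) x ∂μ := by ring

/-- The numerical step of the pinching estimate: a lower bound on `z = ∫ Z²` and the pinching
condition bound `R² - z`. -/
theorem sq_sub_le_of_pinching {m : ℕ} {R h C z : ℝ} (hR : 0 < R) (hh : 0 < h) (hzR : z ≤ R ^ 2)
    (hz : 1 ≤ (R ^ m * h) ^ 2 * z) (hC0 : 0 < C) (hC1 : C < 1) (hpinch : R ^ (m + 1) < 1 / h + C) :
    R ^ 2 - z ≤ C * (h ^ ((2 * ((m + 1 : ℕ) : ℝ) - 2) / ((m + 1 : ℕ) : ℝ))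
      + 2 * h ^ ((((m + 1 : ℕ) : ℝ) - 2) / ((m + 1 : ℕ) : ℝ))) := by
  have hk : ((m + 1 : ℕ) : ℝ) ≠ 0 := by positivity
  set s : ℝ := h ^ (((m + 1 : ℕ) : ℝ)⁻¹) with hs
  have hs0 : 0 < s := by positivity
  have hsk : s ^ (m + 1) = h := Real.rpow_inv_natCast_pow hh.le (by omega)
  have e1 : h ^ ((2 * ((m + 1 : ℕ) : ℝ) - 2) / ((m + 1 : ℕ) : ℝ)) = s ^ (2 * m) := by
    rw [hs, ← Real.rpow_natCast, ← Real.rpow_mul hh.le]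
    congr 1
    push_cast at hk ⊢
    field_simp
    ring
  have e2 : h ^ ((((m + 1 : ℕ) : ℝ) - 2) / ((m + 1 : ℕ) : ℝ)) = s ^ (2 * m) / h := by
    rw [← e1, ← Real.rpow_sub_one hh.ne']
    congr 1
    field_simp
    ring
  rw [e1, e2]
  have hRs : 1 ≤ R * s := by
    have h1 : 1 ≤ (R * s) ^ (m + 1) := by
      rw [mul_pow, hsk]
      refine (one_le_sq_iff₀ (by positivity)).1 ?_
      calc (1 : ℝ) ≤ (R ^ m * h) ^ 2 * z := hz
        _ ≤ (R ^ m * h) ^ 2 * R ^ 2 := by gcongr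
        _ = (R ^ (m + 1) * h) ^ 2 := by ring
    exact (one_le_pow_iff_of_nonneg (by positivity) (by omega)).1 h1
  have hRs' : 1 ≤ (R * s) ^ (2 * m) := one_le_pow₀ hRs
  have hz' : 1 / h ^ 2 ≤ R ^ (2 * m) * z := by
    rw [div_le_iff₀ (by positivity)]
    calc (1 : ℝ) ≤ (R ^ m * h) ^ 2 * z := hz
      _ = R ^ (2 * m) * z * h ^ 2 := by ring
  have hsq : (R ^ (m + 1)) ^ 2 ≤ (1 / h + C) ^ 2 := by gcongr
  have hnn : 0 ≤ R ^ 2 - z := by linarith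
  have hmain : R ^ (2 * m) * (R ^ 2 - z) ≤ C * (1 + 2 / h) := by
    have : C ^ 2 ≤ C := by nlinarith
    have e : (1 / h + C) ^ 2 = 1 / h ^ 2 + C * (2 / h) + C ^ 2 := by field_simp; ring
    have e' : (R ^ (m + 1)) ^ 2 = R ^ (2 * m) * R ^ 2 := by ring
    rw [e, e'] at hsq
    linarith
  calc R ^ 2 - z ≤ (R * s) ^ (2 * m) * (R ^ 2 - z) := le_mul_of_one_le_left hnn hRs'
    _ = s ^ (2 * m) * (R ^ (2 * m) * (R ^ 2 - z)) := by ring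
    _ ≤ s ^ (2 * m) * (C * (1 + 2 / h)) := by gcongr
    _ = C * (s ^ (2 * m) + 2 * (s ^ (2 * m) / h)) := by ring

/-- L²-pinching estimate for ψ = |Zᵀ| (Lemma 4.2, δ = 0) in
measure-theoretic form. -/
theorem pinching_L2_psi_euclidean
    {Ω : Type*} [MeasurableSpace Ω] (μ : Measure Ω) [IsProbabilityMeasure μ]
    (k : ℕ) (hk : 1 ≤ k) (p : ℝ) (hp : 1 ≤ p) (R : ℝ) (hR : 0 < R)
    (r Z ψ : Ω → ℝ) (hr : Measurable r) (hZ : Measurable Z) (hψ : Measurable ψ)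
    (hr' : ∀ᵐ x ∂μ, 0 ≤ r x ∧ r x ≤ R)
    (hψ' : ∀ᵐ x ∂μ, ψ x ^ 2 ≤ r x ^ 2 - Z x ^ 2)
    (H : ℕ → Ω → ℝ) (hH0 : ∀ x, H 0 x = 1)
    (hHint : ∀ j ≤ k, Integrable (H j) μ)
    (hHpos : ∀ j, 1 ≤ j → j ≤ k → ∀ᵐ x ∂μ, 0 < H j x)
    (hHrint : ∀ j ≤ k, Integrable (fun x => H j x * r x) μ)
    (hHZint : Integrable (fun x => H k x * Z x) μ)
    (hHkLp : Integrable (fun x => |H k x| ^ (2 * p)) μ)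
    (h : ℝ) (hh : h = (∫ x, |H k x| ^ (2 * p) ∂μ) ^ (1 / (2 * p)))
    (hmink : ∀ j, 1 ≤ j → j ≤ k - 1 → ∫ x, H (j - 1) x ∂μ ≤ ∫ x, H j x * r x ∂μ)
    (hminkZ : ∫ x, H (k - 1) x ∂μ ≤ ∫ x, H k x * Z x ∂μ)
    (C : ℝ) (hC0 : 0 < C) (hC1 : C < 1) (hpinch : R ^ k < 1 / h + C) :
    ∫ x, ψ x ^ 2 ∂μ
      ≤ C * (h ^ ((2 * (k : ℝ) - 2) / (k : ℝ)) + 2 * h ^ (((k : ℝ) - 2) / (k : ℝ))) := by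
  obtain ⟨m, rfl⟩ : ∃ m, k = m + 1 := ⟨k - 1, by omega⟩
  rw [Nat.add_sub_cancel] at hminkZ hmink
  obtain ⟨hHmem, hHsq⟩ := integral_sq_le_sq_of_integrable_rpow
    (hHint (m + 1) le_rfl).aestronglyMeasurable hp hHkLp
  rw [← hh] at hHsq
  have hZr : ∀ᵐ x ∂μ, Z x ^ 2 ≤ R ^ 2 := by
    filter_upwards [hr', hψ'] with x ⟨h0, h1⟩ h2
    nlinarith [sq_nonneg (ψ x)]
  have hZmem : MemLp Z 2 μ := by
    refine (memLp_top_of_bound hZ.aestronglyMeasurable R ?_).mono_exponent le_top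
    filter_upwards [hZr] with x hx
    exact abs_le_of_sq_le_sq hx hR.le
  have hz0 : 0 ≤ ∫ x, Z x ^ 2 ∂μ := integral_nonneg fun x => sq_nonneg _
  have hzR : ∫ x, Z x ^ 2 ∂μ ≤ R ^ 2 := by
    simpa using integral_mono_ae hZmem.integrable_sq (integrable_const (R ^ 2)) hZr
  have hmean : 1 ≤ R ^ m * ∫ x, H (m + 1) x * Z x ∂μ :=
    (one_le_pow_mul_integral hR.le (hr'.mono fun x hx => hx.2) hH0
      (fun j hj => hHint j (by omega)) (fun j h1 hj => hHpos j h1 (by omega))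
      (fun j hj => hHrint j (by omega)) hmink m le_rfl).trans (by gcongr)
  have hz : 1 ≤ (R ^ m * h) ^ 2 * ∫ x, Z x ^ 2 ∂μ := by
    calc (1 : ℝ) ≤ (R ^ m * ∫ x, H (m + 1) x * Z x ∂μ) ^ 2 := one_le_pow₀ hmean
      _ = (R ^ m) ^ 2 * (∫ x, H (m + 1) x * Z x ∂μ) ^ 2 := by ring
      _ ≤ (R ^ m) ^ 2 * (h ^ 2 * ∫ x, Z x ^ 2 ∂μ) := by
          gcongr
          exact (sq_integral_mul_le hHmem hZmem).trans (by gcongr)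
      _ = (R ^ m * h) ^ 2 * ∫ x, Z x ^ 2 ∂μ := by ring
  have hh0 : 0 < h := by
    refine lt_of_le_of_ne ?_ ?_
    · rw [hh]
      exact Real.rpow_nonneg (integral_nonneg fun x => by positivity) _
    · rintro h0
      rw [← h0] at hz
      norm_num at hz
  have hψint : ∫ x, ψ x ^ 2 ∂μ ≤ R ^ 2 - ∫ x, Z x ^ 2 ∂μ := by
    have hle : ∫ x, ψ x ^ 2 ∂μ ≤ ∫ x, (R ^ 2 - Z x ^ 2) ∂μ := by
      refine integral_mono_of_nonneg (ae_of_all _ fun x => sq_nonneg _)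
        ((integrable_const _).sub hZmem.integrable_sq) ?_
      filter_upwards [hr', hψ'] with x ⟨h0, h1⟩ h2
      nlinarith
    rw [integral_sub (integrable_const _) hZmem.integrable_sq] at hle
    simpa using hle
  exact hψint.trans (sq_sub_le_of_pinching hR hh0 hzR hz hC0 hC1 hpinch)
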